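/- arXiv:1506.02002 — 2 statements merged into one kernel-verified Lean document; each statement's English description precedes it below -/
import Mathlib

section
/- The ring $R = k[x,y,z,w]/((x,y) \cap (z,w))$ is seminormal: for every element $b$ of the total ring of fractions of $R$ with $b^2 \in R$ and $b^3 \in R$, one has $b \in R$. -/
set_option synthInstance.maxHeartbeats 1000000
set_option maxHeartbeats 1000000

open MvPolynomial

namespace TwoPlanes

variable (k : Type*) [Field k]

/-- The ideal `(xz, xw, yz, yw)` of the union of the two planes. -/
noncomputable abbrev planesIdeal : Ideal (MvPolynomial (Fin 4) k) :=
  Ideal.span {(X 0 : MvPolynomial (Fin 4) k) * X 2, X 0 * X 3, X 1 * X 2, X 1 * X 3}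

/-- Restriction to the plane `V(x, y)`, as an idempotent endomorphism of `k[x, y, z, w]`. -/
noncomputable def restrictZW : MvPolynomial (Fin 4) k →ₐ[k] MvPolynomial (Fin 4) k :=
  aeval ![0, 0, X 2, X 3]

/-- Restriction to the plane `V(z, w)`, as an idempotent endomorphism of `k[x, y, z, w]`. -/
noncomputable def restrictXY : MvPolynomial (Fin 4) k →ₐ[k] MvPolynomial (Fin 4) k :=
  aeval ![X 0, X 1, 0, 0]

variable {k}

lemma restrictZW_idem (p : MvPolynomial (Fin 4) k) :
    restrictZW k (restrictZW k p) = restrictZW k p := by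
  have h : (restrictZW k).comp (restrictZW k) = restrictZW k := by
    ext i : 1
    fin_cases i <;> simp [restrictZW]
  exact DFunLike.congr_fun h p

lemma restrictXY_idem (p : MvPolynomial (Fin 4) k) :
    restrictXY k (restrictXY k p) = restrictXY k p := by
  have h : (restrictXY k).comp (restrictXY k) = restrictXY k := by
    ext i : 1
    fin_cases i <;> simp [restrictXY]
  exact DFunLike.congr_fun h p

lemma restrictZW_restrictXY (p : MvPolynomial (Fin 4) k) :
    restrictZW k (restrictXY k p) = C (constantCoeff p) := by
  induction p using MvPolynomial.induction_on with
  | C a => simp [restrictXY, restrictZW, algebraMap_eq]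
  | add p q hp hq => simp only [map_add, hp, hq]
  | mul_X p i hp =>
    simp only [map_mul, hp]
    fin_cases i <;> simp [restrictXY, restrictZW]

lemma restrictXY_restrictZW (p : MvPolynomial (Fin 4) k) :
    restrictXY k (restrictZW k p) = C (constantCoeff p) := by
  induction p using MvPolynomial.induction_on with
  | C a => simp [restrictXY, restrictZW, algebraMap_eq]
  | add p q hp hq => simp only [map_add, hp, hq]
  | mul_X p i hp =>
    simp only [map_mul, hp]
    fin_cases i <;> simp [restrictXY, restrictZW]

lemma constantCoeff_restrictZW (p : MvPolynomial (Fin 4) k) :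
    constantCoeff (restrictZW k p) = constantCoeff p := by
  induction p using MvPolynomial.induction_on with
  | C a => simp [restrictZW, algebraMap_eq]
  | add p q hp hq => simp only [map_add, hp, hq]
  | mul_X p i hp =>
    simp only [map_mul, hp]
    fin_cases i <;> simp [restrictZW]

lemma constantCoeff_restrictXY (p : MvPolynomial (Fin 4) k) :
    constantCoeff (restrictXY k p) = constantCoeff p := by
  induction p using MvPolynomial.induction_on with
  | C a => simp [restrictXY, algebraMap_eq]
  | add p q hp hq => simp only [map_add, hp, hq]
  | mul_X p i hp =>
    simp only [map_mul, hp]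
    fin_cases i <;> simp [restrictXY]

lemma restrictZW_eq_zero_of_mem {p : MvPolynomial (Fin 4) k} (hp : p ∈ planesIdeal k) :
    restrictZW k p = 0 := by
  have h : planesIdeal k ≤ RingHom.ker (restrictZW k) := by
    rw [Ideal.span_le]
    rintro q (rfl | rfl | rfl | rfl) <;> simp [RingHom.mem_ker, restrictZW]
  exact h hp

lemma restrictXY_eq_zero_of_mem {p : MvPolynomial (Fin 4) k} (hp : p ∈ planesIdeal k) :
    restrictXY k p = 0 := by
  have h : planesIdeal k ≤ RingHom.ker (restrictXY k) := by
    rw [Ideal.span_le]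
    rintro q (rfl | rfl | rfl | rfl) <;> simp [RingHom.mem_ker, restrictXY]
  exact h hp

lemma X_mul_X_mem {i j : Fin 4} (hi : i = 0 ∨ i = 1) (hj : j = 2 ∨ j = 3) :
    (X i * X j : MvPolynomial (Fin 4) k) ∈ planesIdeal k := by
  apply Ideal.subset_span
  rcases hi with rfl | rfl <;> rcases hj with rfl | rfl <;> simp

lemma X_mul_restrictZW_sub_mem {i : Fin 4} (hi : i = 0 ∨ i = 1) (p : MvPolynomial (Fin 4) k) :
    X i * (restrictZW k p - C (constantCoeff p)) ∈ planesIdeal k := by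
  induction p using MvPolynomial.induction_on with
  | C a => simp [restrictZW, algebraMap_eq]
  | add p q hp hq =>
    convert add_mem hp hq using 1
    simp only [map_add]
    ring
  | mul_X p j _ =>
    have key (j : Fin 4) (hj : j = 2 ∨ j = 3) :
        X i * (restrictZW k p * X j) ∈ planesIdeal k := by
      rw [mul_left_comm]
      exact Ideal.mul_mem_left _ _ (X_mul_X_mem hi hj)
    fin_cases j
    · simp [restrictZW]
    · simp [restrictZW]
    · simpa [restrictZW] using key 2 (by simp)
    · simpa [restrictZW] using key 3 (by simp)

lemma X_mul_restrictXY_sub_mem {j : Fin 4} (hj : j = 2 ∨ j = 3) (p : MvPolynomial (Fin 4) k) :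
    X j * (restrictXY k p - C (constantCoeff p)) ∈ planesIdeal k := by
  induction p using MvPolynomial.induction_on with
  | C a => simp [restrictXY, algebraMap_eq]
  | add p q hp hq =>
    convert add_mem hp hq using 1
    simp only [map_add]
    ring
  | mul_X p i _ =>
    have key (i : Fin 4) (hi : i = 0 ∨ i = 1) :
        X j * (restrictXY k p * X i) ∈ planesIdeal k := by
      rw [mul_left_comm, mul_comm (X j)]
      exact Ideal.mul_mem_left _ _ (X_mul_X_mem hi hj)
    fin_cases i
    · simpa [restrictXY] using key 0 (by simp)
    · simpa [restrictXY] using key 1 (by simp)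
    · simp [restrictXY]
    · simp [restrictXY]

lemma sub_restrict_mem (p : MvPolynomial (Fin 4) k) :
    p - restrictZW k p - restrictXY k p + C (constantCoeff p) ∈ planesIdeal k := by
  induction p using MvPolynomial.induction_on with
  | C a => simp [restrictXY, restrictZW, algebraMap_eq]
  | add p q hp hq =>
    convert add_mem hp hq using 1
    simp only [map_add]
    ring
  | mul_X p i hp =>
    have hXY (i : Fin 4) (hi : i = 0 ∨ i = 1) :
        p * X i - restrictXY k p * X i ∈ planesIdeal k := by
      convert add_mem (Ideal.mul_mem_left _ (X i) hp) (X_mul_restrictZW_sub_mem hi p) using 1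
      ring
    have hZW (i : Fin 4) (hi : i = 2 ∨ i = 3) :
        p * X i - restrictZW k p * X i ∈ planesIdeal k := by
      convert add_mem (Ideal.mul_mem_left _ (X i) hp) (X_mul_restrictXY_sub_mem hi p) using 1
      ring
    fin_cases i
    · simpa [restrictXY, restrictZW] using hXY 0 (by simp)
    · simpa [restrictXY, restrictZW] using hXY 1 (by simp)
    · simpa [restrictXY, restrictZW] using hZW 2 (by simp)
    · simpa [restrictXY, restrictZW] using hZW 3 (by simp)

lemma mem_planesIdeal_of_restrict_eq_zero {p : MvPolynomial (Fin 4) k}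
    (hZW : restrictZW k p = 0) (hXY : restrictXY k p = 0) : p ∈ planesIdeal k := by
  have h0 : constantCoeff p = 0 := by rw [← constantCoeff_restrictZW, hZW, map_zero]
  simpa [hZW, hXY, h0] using sub_restrict_mem p

lemma restrictZW_ne_zero {s : MvPolynomial (Fin 4) k}
    (hs : ∀ q, s * q ∈ planesIdeal k → q ∈ planesIdeal k) : restrictZW k s ≠ 0 := by
  intro h
  have h2 : (X 2 : MvPolynomial (Fin 4) k) ∈ planesIdeal k :=
    hs _ (mem_planesIdeal_of_restrict_eq_zero (by simp [h]) (by simp [restrictXY]))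
  simpa [restrictZW] using restrictZW_eq_zero_of_mem h2

lemma restrictXY_ne_zero {s : MvPolynomial (Fin 4) k}
    (hs : ∀ q, s * q ∈ planesIdeal k → q ∈ planesIdeal k) : restrictXY k s ≠ 0 := by
  intro h
  have h0 : (X 0 : MvPolynomial (Fin 4) k) ∈ planesIdeal k :=
    hs _ (mem_planesIdeal_of_restrict_eq_zero (by simp [restrictZW]) (by simp [h]))
  simpa [restrictXY] using restrictXY_eq_zero_of_mem h0

/-- In the image of an idempotent endomorphism of an integrally closed domain, a fraction `p / s`
whose square and cube are `c` and `d` is an element of that image. -/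
lemma exists_eq_mul_of_sq_of_cube {A : Type*} [CommRing A] [IsDomain A] [IsIntegrallyClosed A]
    (e : A →+* A) (he : ∀ a, e (e a) = e a) {p s c d : A} (hs : e s ≠ 0)
    (h2 : e (p ^ 2) = e (c * s ^ 2)) (h3 : e (p ^ 3) = e (d * s ^ 3)) :
    ∃ f, e f = f ∧ e p = e s * f ∧ f ^ 2 = e c ∧ f ^ 3 = e d := by
  simp only [map_mul, map_pow] at h2 h3
  obtain ⟨f, hf⟩ : e s ∣ e p :=
    (IsIntegrallyClosed.pow_dvd_pow_iff two_ne_zero).1 ⟨e c, by rw [h2, mul_comm]⟩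
  have hef : e f = f := by
    apply mul_left_cancel₀ hs
    rw [← hf, ← he p, hf, map_mul, he]
  refine ⟨f, hef, hf, ?_, ?_⟩
  · apply mul_right_cancel₀ (pow_ne_zero 2 hs)
    rw [← h2, hf]
    ring
  · apply mul_right_cancel₀ (pow_ne_zero 3 hs)
    rw [← h3, hf]
    ring

lemma eq_of_sq_eq_sq_of_cube_eq_cube {K : Type*} [Field K] {a b : K}
    (h2 : a ^ 2 = b ^ 2) (h3 : a ^ 3 = b ^ 3) : a = b := by
  by_cases hb : b = 0
  · subst hb
    simpa using h2
  · apply mul_left_cancel₀ (pow_ne_zero 2 hb)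
    linear_combination h3 - a * h2

theorem exists_sub_mul_mem {p s c d : MvPolynomial (Fin 4) k}
    (hs : ∀ q, s * q ∈ planesIdeal k → q ∈ planesIdeal k)
    (h2 : p ^ 2 - c * s ^ 2 ∈ planesIdeal k) (h3 : p ^ 3 - d * s ^ 3 ∈ planesIdeal k) :
    ∃ r, p - s * r ∈ planesIdeal k := by
  obtain ⟨f, hf, hpf, hf2, hf3⟩ := exists_eq_mul_of_sq_of_cube (restrictZW k).toRingHom
    restrictZW_idem (restrictZW_ne_zero hs)
    (sub_eq_zero.1 (by simpa using restrictZW_eq_zero_of_mem h2))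
    (sub_eq_zero.1 (by simpa using restrictZW_eq_zero_of_mem h3))
  obtain ⟨g, hg, hpg, hg2, hg3⟩ := exists_eq_mul_of_sq_of_cube (restrictXY k).toRingHom
    restrictXY_idem (restrictXY_ne_zero hs)
    (sub_eq_zero.1 (by simpa using restrictXY_eq_zero_of_mem h2))
    (sub_eq_zero.1 (by simpa using restrictXY_eq_zero_of_mem h3))
  simp only [AlgHom.toRingHom_eq_coe, RingHom.coe_coe] at hf hpf hf2 hf3 hg hpg hg2 hg3
  have hfg : constantCoeff f = constantCoeff g := by
    apply eq_of_sq_eq_sq_of_cube_eq_cube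
    · rw [← map_pow, ← map_pow, hf2, hg2, constantCoeff_restrictZW, constantCoeff_restrictXY]
    · rw [← map_pow, ← map_pow, hf3, hg3, constantCoeff_restrictZW, constantCoeff_restrictXY]
  have hfg' : restrictZW k g = C (constantCoeff g) := by rw [← hg, restrictZW_restrictXY, hg]
  have hgf' : restrictXY k f = C (constantCoeff f) := by rw [← hf, restrictXY_restrictZW, hf]
  refine ⟨f + g - C (constantCoeff g), mem_planesIdeal_of_restrict_eq_zero ?_ ?_⟩
  · have hC : restrictZW k (C (constantCoeff g)) = C (constantCoeff g) := (restrictZW k).commutes _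
    simp only [map_sub, map_mul, map_add, hC, hf, hfg', hpf]
    ring
  · have hC : restrictXY k (C (constantCoeff g)) = C (constantCoeff g) := (restrictXY k).commutes _
    simp only [map_sub, map_mul, map_add, hC, hg, hgf', hpg, hfg]
    ring

end TwoPlanes

/-- The ring `R = k[x,y,z,w]/((x,y) ∩ (z,w)) = k[x,y,z,w]/(xz,xw,yz,yw)` is seminormal:
for every element `b` of its total ring of fractions with `b² ∈ R` and `b³ ∈ R`,
one has `b ∈ R`. -/
theorem stmt4 (k : Type*) [Field k] :
    letI R := MvPolynomial (Fin 4) k ⧸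
      Ideal.span {(X 0 : MvPolynomial (Fin 4) k) * X 2, X 0 * X 3, X 1 * X 2, X 1 * X 3}
    ∀ b : FractionRing R,
      b ^ 2 ∈ (algebraMap R (FractionRing R)).range →
      b ^ 3 ∈ (algebraMap R (FractionRing R)).range →
      b ∈ (algebraMap R (FractionRing R)).range := by
  rintro b ⟨c, hc⟩ ⟨d, hd⟩
  obtain ⟨⟨p, s, hs⟩, hb⟩ := IsLocalization.surj (nonZeroDivisors
    (MvPolynomial (Fin 4) k ⧸ TwoPlanes.planesIdeal k)) b
  obtain ⟨p, rfl⟩ := Ideal.Quotient.mk_surjective p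
  obtain ⟨s, rfl⟩ := Ideal.Quotient.mk_surjective s
  obtain ⟨c, rfl⟩ := Ideal.Quotient.mk_surjective c
  obtain ⟨d, rfl⟩ := Ideal.Quotient.mk_surjective d
  have hinj := IsFractionRing.injective (MvPolynomial (Fin 4) k ⧸ TwoPlanes.planesIdeal k)
    (FractionRing (MvPolynomial (Fin 4) k ⧸ TwoPlanes.planesIdeal k))
  obtain ⟨r, hr⟩ := TwoPlanes.exists_sub_mul_mem (p := p) (s := s) (c := c) (d := d)
    (fun q hq ↦ by
      rw [← Ideal.Quotient.eq_zero_iff_mem] at hq ⊢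
      rw [map_mul, mul_comm] at hq
      exact (mul_right_mem_nonZeroDivisors_eq_zero_iff hs).1 hq)
    (by
      rw [← Ideal.Quotient.eq]
      apply hinj
      rw [map_pow, map_pow, ← hb, map_mul, map_mul, hc, map_pow, map_pow, mul_pow])
    (by
      rw [← Ideal.Quotient.eq]
      apply hinj
      rw [map_pow, map_pow, ← hb, map_mul, map_mul, hd, map_pow, map_pow, mul_pow])
  refine ⟨Ideal.Quotient.mk _ r, ?_⟩
  rw [← Ideal.Quotient.eq, map_mul] at hr
  apply (IsLocalization.map_units (FractionRing (MvPolynomial (Fin 4) k ⧸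
    TwoPlanes.planesIdeal k)) ⟨_, hs⟩).mul_right_cancel
  rw [hb, hr, map_mul, mul_comm]
end

section
/- Let $k$ be a field. The fiber product ring $A = \big(k[u_0,u_3,u_5]/(u_0u_5 - u_3^2)\big) \times_{k[u_5]} \big(k[u_2,u_4,u_5]/(u_2u_5 - u_4^2)\big)$, taken along the maps killing $u_0, u_3$ and $u_2, u_4$ respectively, is isomorphic to $k[u_0,u_2,u_3,u_4,u_5]/(u_2u_5-u_4^2,\; u_0u_5-u_3^2,\; u_0u_2,\; u_3u_4,\; u_0u_4,\; u_2u_3)$. -/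
set_option synthInstance.maxHeartbeats 1000000
set_option maxHeartbeats 1000000

open MvPolynomial

/-- The quadric cone `k[a,b,c]/(ac - b²)` (coordinates `(u₀,u₃,u₅)` resp. `(u₂,u₄,u₅)`). -/
noncomputable abbrev QuadCone (k : Type*) [Field k] :=
  MvPolynomial (Fin 3) k ⧸
    Ideal.span {(X 0 : MvPolynomial (Fin 3) k) * X 2 - (X 1 : MvPolynomial (Fin 3) k) ^ 2}

/-- The algebra map out of the quadric cone given by a point `(a, b, c)` with `ac = b²`. -/
noncomputable def QuadCone.lift {k S : Type*} [Field k] [CommRing S] [Algebra k S]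
    (v : Fin 3 → S) (h : v 0 * v 2 = v 1 ^ 2) : QuadCone k →ₐ[k] S :=
  Ideal.Quotient.liftₐ _ (aeval v) fun a ha => by
    have hle : Ideal.span {(X 0 : MvPolynomial (Fin 3) k) * X 2 - X 1 ^ 2} ≤
        RingHom.ker (aeval v : MvPolynomial (Fin 3) k →ₐ[k] S) := by
      rw [Ideal.span_le, Set.singleton_subset_iff]
      simp [RingHom.mem_ker, h]
    exact hle ha

lemma QuadCone.lift_mk_X {k S : Type*} [Field k] [CommRing S] [Algebra k S]
    (v : Fin 3 → S) (h : v 0 * v 2 = v 1 ^ 2) (i : Fin 3) :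
    QuadCone.lift (k := k) v h (Ideal.Quotient.mk _ (X i)) = v i :=
  aeval_X v i

/-- Two algebra maps out of a quotient of a polynomial ring which agree on the variables after
multiplication by `u` agree everywhere after multiplication by `u`. -/
lemma MvPolynomial.mul_quotient_algHom_congr {k σ S : Type*} [Field k] [CommRing S] [Algebra k S]
    {I : Ideal (MvPolynomial σ k)} (f g : (MvPolynomial σ k ⧸ I) →ₐ[k] S) (u : S)
    (h : ∀ i, u * f (Ideal.Quotient.mk I (X i)) = u * g (Ideal.Quotient.mk I (X i)))
    (x : MvPolynomial σ k ⧸ I) : u * f x = u * g x := by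
  obtain ⟨p, rfl⟩ := Ideal.Quotient.mk_surjective x
  induction p using MvPolynomial.induction_on with
  | C a =>
    have hf : f (Ideal.Quotient.mk I (C a)) = algebraMap k S a := f.commutes a
    have hg : g (Ideal.Quotient.mk I (C a)) = algebraMap k S a := g.commutes a
    rw [hf, hg]
  | add p q hp hq => simp only [map_add, mul_add, hp, hq]
  | mul_X p i hp =>
    simp only [map_mul]
    linear_combination f (Ideal.Quotient.mk I (X i)) * hp + g (Ideal.Quotient.mk I p) * h i

lemma MvPolynomial.quotient_algHom_congr {k σ S : Type*} [Field k] [CommRing S] [Algebra k S]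
    {I : Ideal (MvPolynomial σ k)} (f g : (MvPolynomial σ k ⧸ I) →ₐ[k] S)
    (h : ∀ i, f (Ideal.Quotient.mk I (X i)) = g (Ideal.Quotient.mk I (X i)))
    (x : MvPolynomial σ k ⧸ I) : f x = g x := by
  simpa using mul_quotient_algHom_congr f g 1 (by simpa using h) x

/-- The ideal of the two quadric cones glued along a line. -/
noncomputable abbrev gluedConesIdeal (k : Type*) [Field k] : Ideal (MvPolynomial (Fin 5) k) :=
  Ideal.span {(X 1 : MvPolynomial (Fin 5) k) * X 4 - (X 3 : MvPolynomial (Fin 5) k) ^ 2,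
    (X 0 : MvPolynomial (Fin 5) k) * X 4 - (X 2 : MvPolynomial (Fin 5) k) ^ 2,
    X 0 * X 1, X 2 * X 3, X 0 * X 3, X 1 * X 2}

/-- The coordinate ring of the two quadric cones glued along a line. -/
noncomputable abbrev GluedCones (k : Type*) [Field k] :=
  MvPolynomial (Fin 5) k ⧸ gluedConesIdeal k

namespace GluedCones

/-- The class of a variable. -/
noncomputable abbrev var (k : Type*) [Field k] (i : Fin 5) : GluedCones k :=
  Ideal.Quotient.mk (gluedConesIdeal k) (X i)

lemma relations (k : Type*) [Field k] :
    var k 1 * var k 4 = var k 3 ^ 2 ∧ var k 0 * var k 4 = var k 2 ^ 2 ∧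
      var k 0 * var k 1 = 0 ∧ var k 2 * var k 3 = 0 ∧
      var k 0 * var k 3 = 0 ∧ var k 1 * var k 2 = 0 := by
  refine ⟨?_, ?_, ?_, ?_, ?_, ?_⟩
  on_goal 1 => rw [← sub_eq_zero]
  on_goal 2 => rw [← sub_eq_zero]
  all_goals
    simp only [var, ← map_mul, ← map_pow, ← map_sub]
    exact Ideal.Quotient.eq_zero_iff_mem.2 (Ideal.subset_span (by simp))

/-- The algebra map out of the glued cones given by a point satisfying the equations. -/
noncomputable def lift {k S : Type*} [Field k] [CommRing S] [Algebra k S] (v : Fin 5 → S)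
    (h : v 1 * v 4 = v 3 ^ 2 ∧ v 0 * v 4 = v 2 ^ 2 ∧ v 0 * v 1 = 0 ∧ v 2 * v 3 = 0 ∧
      v 0 * v 3 = 0 ∧ v 1 * v 2 = 0) : GluedCones k →ₐ[k] S :=
  Ideal.Quotient.liftₐ _ (aeval v) fun a ha => by
    have hle : gluedConesIdeal k ≤
        RingHom.ker (aeval v : MvPolynomial (Fin 5) k →ₐ[k] S) := by
      obtain ⟨h1, h2, h3, h4, h5, h6⟩ := h
      rw [Ideal.span_le]
      rintro _ (rfl | rfl | rfl | rfl | rfl | rfl) <;>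
        simp [RingHom.mem_ker, h1, h2, h3, h4, h5, h6]
    exact hle ha

lemma lift_var {k S : Type*} [Field k] [CommRing S] [Algebra k S] (v : Fin 5 → S)
    (h : v 1 * v 4 = v 3 ^ 2 ∧ v 0 * v 4 = v 2 ^ 2 ∧ v 0 * v 1 = 0 ∧ v 2 * v 3 = 0 ∧
      v 0 * v 3 = 0 ∧ v 1 * v 2 = 0) (i : Fin 5) :
    lift (k := k) v h (var k i) = v i :=
  aeval_X v i

end GluedCones

lemma QuadCone.relation (k : Type*) [Field k] :
    (Ideal.Quotient.mk _ (X 0) : QuadCone k) * Ideal.Quotient.mk _ (X 2) =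
      Ideal.Quotient.mk _ (X 1) ^ 2 := by
  rw [← sub_eq_zero, ← map_mul, ← map_pow, ← map_sub]
  exact Ideal.Quotient.eq_zero_iff_mem.2 (Ideal.subset_span rfl)

/-- A map to a fiber product with components `α`, `β` is bijective if it has an additive
one-sided inverse built from sections of `α` and `β`. -/
lemma AlgHom.nonempty_equalizer_equiv {k A₁ A₂ B R : Type*} [CommRing k] [CommRing A₁]
    [CommRing A₂] [CommRing B] [CommRing R] [Algebra k A₁] [Algebra k A₂] [Algebra k B]
    [Algebra k R] (φ : A₁ →ₐ[k] R) (ψ : A₂ →ₐ[k] R) (α : B →ₐ[k] A₁) (β : B →ₐ[k] A₂)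
    (s₁ : A₁ →ₐ[k] B) (s₂ : A₂ →ₐ[k] B) (t : R →ₐ[k] B)
    (hc : ∀ x, φ (α x) = ψ (β x))
    (hα₁ : ∀ a, α (s₁ a) = a) (hβ₂ : ∀ b, β (s₂ b) = b)
    (hα₂ : ∀ b, α (s₂ b) = α (t (ψ b))) (hβ₁ : ∀ a, β (s₁ a) = β (t (φ a)))
    (hB : ∀ x, x = s₁ (α x) + s₂ (β x) - t (φ (α x))) :
    Nonempty ((AlgHom.equalizer (φ.comp (AlgHom.fst k A₁ A₂))
      (ψ.comp (AlgHom.snd k A₁ A₂))) ≃ₐ[k] B) := by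
  refine ⟨(AlgEquiv.ofBijective ((α.prod β).codRestrict _ hc) ⟨?_, ?_⟩).symm⟩
  · refine (injective_iff_map_eq_zero _).2 fun x hx => ?_
    have h := congrArg Subtype.val hx
    have h1 : α x = 0 := congrArg Prod.fst h
    have h2 : β x = 0 := congrArg Prod.snd h
    rw [hB x, h1, h2]
    simp
  · rintro ⟨⟨a, b⟩, hab⟩
    have hab : φ a = ψ b := hab
    refine ⟨s₁ a + s₂ b - t (φ a), Subtype.ext (Prod.ext ?_ ?_)⟩
    · change α (s₁ a + s₂ b - t (φ a)) = a
      rw [map_sub, map_add, hα₁, hα₂, hab, add_sub_cancel_right]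
    · change β (s₁ a + s₂ b - t (φ a)) = b
      rw [map_sub, map_add, hβ₂, hβ₁, add_sub_cancel_left]

/-- The fiber product of two quadric cones `k[u₀,u₃,u₅]/(u₀u₅-u₃²)` and
`k[u₂,u₄,u₅]/(u₂u₅-u₄²)` over `k[u₅]`, along the maps killing `u₀,u₃` resp. `u₂,u₄`,
is isomorphic to
`k[u₀,u₂,u₃,u₄,u₅]/(u₂u₅-u₄², u₀u₅-u₃², u₀u₂, u₃u₄, u₀u₄, u₂u₃)`
(variables ordered `u₀,u₂,u₃,u₄,u₅` as `X 0,…,X 4`). -/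
theorem stmt12 (k : Type*) [Field k]
    (φ ψ : QuadCone k →ₐ[k] Polynomial k)
    (hφ0 : φ (Ideal.Quotient.mk _ (X 0)) = 0)
    (hφ1 : φ (Ideal.Quotient.mk _ (X 1)) = 0)
    (hφ2 : φ (Ideal.Quotient.mk _ (X 2)) = Polynomial.X)
    (hψ0 : ψ (Ideal.Quotient.mk _ (X 0)) = 0)
    (hψ1 : ψ (Ideal.Quotient.mk _ (X 1)) = 0)
    (hψ2 : ψ (Ideal.Quotient.mk _ (X 2)) = Polynomial.X) :
    Nonempty ((AlgHom.equalizer (φ.comp (AlgHom.fst k (QuadCone k) (QuadCone k)))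
        (ψ.comp (AlgHom.snd k (QuadCone k) (QuadCone k)))) ≃ₐ[k]
      (MvPolynomial (Fin 5) k ⧸
        Ideal.span {(X 1 : MvPolynomial (Fin 5) k) * X 4 - (X 3 : MvPolynomial (Fin 5) k) ^ 2,
          (X 0 : MvPolynomial (Fin 5) k) * X 4 - (X 2 : MvPolynomial (Fin 5) k) ^ 2,
          X 0 * X 1, X 2 * X 3, X 0 * X 3, X 1 * X 2})) := by
  obtain ⟨r1, r2, r3, r4, r5, r6⟩ := GluedCones.relations k
  let q : Fin 3 → QuadCone k := fun i => Ideal.Quotient.mk _ (X i)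
  have hq : q 0 * q 2 = q 1 ^ 2 := QuadCone.relation k
  let α : GluedCones k →ₐ[k] QuadCone k :=
    GluedCones.lift ![q 0, 0, q 1, 0, q 2] (by simp [hq])
  let β : GluedCones k →ₐ[k] QuadCone k :=
    GluedCones.lift ![0, q 0, 0, q 1, q 2] (by simp [hq])
  let w := GluedCones.var k
  let s₁ : QuadCone k →ₐ[k] GluedCones k := QuadCone.lift ![w 0, w 2, w 4] r2
  let s₂ : QuadCone k →ₐ[k] GluedCones k := QuadCone.lift ![w 1, w 3, w 4] r1
  let t : Polynomial k →ₐ[k] GluedCones k := Polynomial.aeval (w 4)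
  have hα : ∀ i, α (w i) = ![q 0, 0, q 1, 0, q 2] i := GluedCones.lift_var _ _
  have hβ : ∀ i, β (w i) = ![0, q 0, 0, q 1, q 2] i := GluedCones.lift_var _ _
  have hs₁ : ∀ i, s₁ (q i) = ![w 0, w 2, w 4] i := QuadCone.lift_mk_X _ _
  have hs₂ : ∀ i, s₂ (q i) = ![w 1, w 3, w 4] i := QuadCone.lift_mk_X _ _
  have ht : t Polynomial.X = w 4 := Polynomial.aeval_X _
  have hφ : ∀ i, φ (q i) = ![0, 0, Polynomial.X] i := by
    intro i; fin_cases i <;> assumption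
  have hψ : ∀ i, ψ (q i) = ![0, 0, Polynomial.X] i := by
    intro i; fin_cases i <;> assumption
  have hc : ∀ x, φ (α x) = ψ (β x) := by
    refine quotient_algHom_congr (φ.comp α) (ψ.comp β) fun i => ?_
    change φ (α (w i)) = ψ (β (w i))
    rw [hα, hβ]
    fin_cases i <;> simp [hφ, hψ]
  have hu₂ : ∀ u : GluedCones k, u * w 1 = 0 → u * w 3 = 0 →
      ∀ b, u * s₂ b = u * t (ψ b) := by
    intro u h1 h3
    refine mul_quotient_algHom_congr s₂ (t.comp ψ) u fun i => ?_
    change u * s₂ (q i) = u * t (ψ (q i))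
    rw [hs₂, hψ]
    fin_cases i <;> simp [h1, h3, ht]
  have hu₁ : ∀ u : GluedCones k, u * w 0 = 0 → u * w 2 = 0 →
      ∀ a, u * s₁ a = u * t (φ a) := by
    intro u h0 h2
    refine mul_quotient_algHom_congr s₁ (t.comp φ) u fun i => ?_
    change u * s₁ (q i) = u * t (φ (q i))
    rw [hs₁, hφ]
    fin_cases i <;> simp [h0, h2, ht]
  refine AlgHom.nonempty_equalizer_equiv φ ψ α β s₁ s₂ t hc ?_ ?_ ?_ ?_ ?_
  · refine quotient_algHom_congr (α.comp s₁) (AlgHom.id k _) fun i => ?_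
    change α (s₁ (q i)) = q i
    rw [hs₁]
    fin_cases i <;> simp [hα]
  · refine quotient_algHom_congr (β.comp s₂) (AlgHom.id k _) fun i => ?_
    change β (s₂ (q i)) = q i
    rw [hs₂]
    fin_cases i <;> simp [hβ]
  · refine quotient_algHom_congr (α.comp s₂) ((α.comp t).comp ψ) fun i => ?_
    change α (s₂ (q i)) = α (t (ψ (q i)))
    rw [hs₂, hψ]
    fin_cases i <;> simp [hα, ht]
  · refine quotient_algHom_congr (β.comp s₁) ((β.comp t).comp φ) fun i => ?_
    change β (s₁ (q i)) = β (t (φ (q i)))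
    rw [hs₁, hφ]
    fin_cases i <;> simp [hβ, ht]
  · intro x
    obtain ⟨p, rfl⟩ := Ideal.Quotient.mk_surjective x
    induction p using MvPolynomial.induction_on with
    | C a =>
      change algebraMap k (GluedCones k) a = s₁ (α (algebraMap k (GluedCones k) a)) +
        s₂ (β (algebraMap k (GluedCones k) a)) - t (φ (α (algebraMap k (GluedCones k) a)))
      simp only [AlgHom.commutes, add_sub_cancel_right]
    | add p p' hp hp' =>
      simp only [map_add]
      linear_combination hp + hp'
    | mul_X p i hp =>
      rw [map_mul]
      change _ * w i = s₁ (α (_ * w i)) + s₂ (β (_ * w i)) - t (φ (α (_ * w i)))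
      set y : GluedCones k := Ideal.Quotient.mk _ p
      have hcy := congrArg t (hc y)
      simp only [map_mul, hα, hβ]
      fin_cases i <;> simp [hs₁, hs₂, hφ, ht]
      · linear_combination w 0 * hp + hu₂ (w 0) r3 r5 (β y) - w 0 * hcy
      · linear_combination w 1 * hp + hu₁ (w 1) ((mul_comm _ _).trans r3) r6 (α y)
      · linear_combination w 2 * hp +
          hu₂ (w 2) ((mul_comm _ _).trans r6) r4 (β y) - w 2 * hcy
      · linear_combination w 3 * hp +
          hu₁ (w 3) ((mul_comm _ _).trans r5) ((mul_comm _ _).trans r4) (α y)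
      · linear_combination w 4 * hp
end
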